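/- arXiv:1304.5150 — 8 statements merged into one kernel-verified Lean document; each statement's English description precedes it below -/
import Mathlib

section
/- Let μ and ν be Borel probability measures on [0,1]. The following are equivalent: (i) for every function f : [0,1] → ℝ that is nonincreasing and concave on [0,1], ∫ f dμ ≤ ∫ f dν; (ii) for every z ∈ [0,1], Λ_μ(z) ≤ Λ_ν(z). (This is the equivalence of conditions (ii) and (iii) in the characterization of channel degradation: ν is the |D|-distribution of a channel degraded with respect to the channel with |D|-distribution μ.) -/
open MeasureTheory Real Set

/-- `Λ_μ(z) = ∫ (1 - max(z,x)) dμ(x)`. -/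
noncomputable def Lam (μ : Measure ℝ) (z : ℝ) : ℝ := ∫ x, (1 - max z x) ∂μ

/-- The piecewise linear interpolation of `f` at the points `k / n`, `0 ≤ k ≤ n`. -/
noncomputable def linInterp (f : ℝ → ℝ) (n : ℕ) (x : ℝ) : ℝ :=
  f 1 + ∑ k ∈ Finset.range n, n * (f (k / n) - f ((k + 1 : ℕ) / n)) *
    ((1 - max ((k : ℝ) / n) x) - (1 - max (((k + 1 : ℕ) : ℝ) / n) x))

lemma natCast_div_mem_Icc {n k : ℕ} (hk : k ≤ n) : (k : ℝ) / n ∈ Icc (0 : ℝ) 1 :=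
  ⟨by positivity, div_le_one_of_le₀ (by exact_mod_cast hk) (by positivity)⟩

lemma natCast_div_le_natCast_div {n k l : ℕ} (h : k ≤ l) : (k : ℝ) / n ≤ (l : ℝ) / n := by
  gcongr

lemma linInterp_antitone {f : ℝ → ℝ} (hf : AntitoneOn f (Icc 0 1)) (n : ℕ) :
    Antitone (linInterp f n) := by
  intro x y hxy
  refine add_le_add_right (Finset.sum_le_sum fun k hk => mul_le_mul_of_nonneg_left ?_ ?_) _
  · have h : (k : ℝ) / n ≤ (k + 1 : ℕ) / n := natCast_div_le_natCast_div k.le_succ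
    generalize (k : ℝ) / n = a at h ⊢
    generalize ((k + 1 : ℕ) : ℝ) / n = b at h ⊢
    grind
  · rw [Finset.mem_range] at hk
    exact mul_nonneg (by positivity) (sub_nonneg.2 (hf (natCast_div_mem_Icc hk.le)
      (natCast_div_mem_Icc hk) (natCast_div_le_natCast_div k.le_succ)))

lemma linInterp_natCast_div (f : ℝ → ℝ) {n m : ℕ} (hn : 0 < n) (hm : m ≤ n) :
    linInterp f n (m / n) = f (m / n) := by
  have hn' : (n : ℝ) ≠ 0 := by positivity
  have key : ∀ l, m ≤ l → ∑ k ∈ Finset.range l, n * (f (k / n) - f ((k + 1 : ℕ) / n)) *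
      ((1 - max ((k : ℝ) / n) (m / n)) - (1 - max (((k + 1 : ℕ) : ℝ) / n) (m / n))) =
      f (m / n) - f (l / n) := by
    intro l hl
    induction l, hl using Nat.le_induction with
    | base =>
      rw [sub_self]
      refine Finset.sum_eq_zero fun k hk => ?_
      rw [Finset.mem_range] at hk
      rw [max_eq_right (natCast_div_le_natCast_div hk.le),
        max_eq_right (natCast_div_le_natCast_div hk), sub_self, mul_zero]
    | succ l hl ih =>
      rw [Finset.sum_range_succ, ih, max_eq_left (natCast_div_le_natCast_div hl),
        max_eq_left (natCast_div_le_natCast_div (hl.trans l.le_succ))]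
      have : (1 - (l : ℝ) / n) - (1 - ((l + 1 : ℕ) : ℝ) / n) = 1 / n := by
        push_cast; ring
      rw [this]
      field_simp
      ring
  rw [linInterp, key n hm, div_self hn']
  ring

lemma tendsto_linInterp {f : ℝ → ℝ} (hf : AntitoneOn f (Icc 0 1))
    (hc : ConcaveOn ℝ (Icc 0 1) f) {x : ℝ} (hx : x ∈ Icc (0 : ℝ) 1) :
    Filter.Tendsto (fun n => linInterp f n x) Filter.atTop (nhds (f x)) := by
  have hfloor : Filter.Tendsto (fun n : ℕ => f (⌊x * n⌋₊ / n)) Filter.atTop (nhds (f x)) ∧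
      Filter.Tendsto (fun n : ℕ => f (⌈x * n⌉₊ / n)) Filter.atTop (nhds (f x)) := by
    rcases hx.1.eq_or_lt with rfl | h0
    · simp
    rcases hx.2.eq_or_lt with rfl | h1
    · constructor <;>
      · refine tendsto_const_nhds.congr' ?_
        filter_upwards [Filter.eventually_gt_atTop 0] with n hn
        have : (n : ℝ) ≠ 0 := by positivity
        simp [this]
    have hcont : ContinuousAt f x := by
      have := hc.continuousOn_interior
      rw [interior_Icc] at this
      exact this.continuousAt (Ioo_mem_nhds h0 h1)
    exact ⟨hcont.tendsto.comp ((tendsto_nat_floor_mul_div_atTop hx.1).comp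
        tendsto_natCast_atTop_atTop),
      hcont.tendsto.comp ((tendsto_nat_ceil_mul_div_atTop hx.1).comp
        tendsto_natCast_atTop_atTop)⟩
  refine tendsto_of_tendsto_of_tendsto_of_le_of_le' hfloor.2 hfloor.1 ?_ ?_
  all_goals
    filter_upwards [Filter.eventually_gt_atTop 0] with n hn
    have hn' : (0 : ℝ) < n := by positivity
    have hxn : x * n ≤ n := by nlinarith [hx.2]
  · rw [← linInterp_natCast_div f hn (Nat.ceil_le.2 hxn)]
    exact linInterp_antitone hf n ((le_div_iff₀ hn').2 (Nat.le_ceil _))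
  · rw [← linInterp_natCast_div f hn (Nat.floor_le_of_le hxn)]
    exact linInterp_antitone hf n
      ((div_le_iff₀ hn').2 (Nat.floor_le (mul_nonneg hx.1 hn'.le)))

lemma integrable_one_sub_max {μ : Measure ℝ} [IsFiniteMeasure μ]
    (hμ : ∀ᵐ x ∂μ, x ∈ Icc (0 : ℝ) 1) {z : ℝ} (hz : z ∈ Icc (0 : ℝ) 1) :
    Integrable (fun x => 1 - max z x) μ := by
  refine Integrable.of_bound (by fun_prop) 1 ?_
  filter_upwards [hμ] with x hx
  rw [Real.norm_eq_abs, abs_le]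
  grind

lemma Lam_one {μ : Measure ℝ} (hμ : ∀ᵐ x ∂μ, x ∈ Icc (0 : ℝ) 1) : Lam μ 1 = 0 := by
  refine integral_eq_zero_of_ae ?_
  filter_upwards [hμ] with x hx
  simp [max_eq_left hx.2]

lemma integral_linInterp {μ : Measure ℝ} [IsProbabilityMeasure μ]
    (hμ : ∀ᵐ x ∂μ, x ∈ Icc (0 : ℝ) 1) (f : ℝ → ℝ) (n : ℕ) :
    ∫ x, linInterp f n x ∂μ = f 1 + ∑ k ∈ Finset.range n,
      n * (f (k / n) - f ((k + 1 : ℕ) / n)) * (Lam μ (k / n) - Lam μ ((k + 1 : ℕ) / n)) := by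
  have hi : ∀ k ≤ n, Integrable (fun x => 1 - max ((k : ℝ) / n) x) μ := fun k hk =>
    integrable_one_sub_max hμ (natCast_div_mem_Icc hk)
  have hs : ∀ k ∈ Finset.range n, Integrable (fun x => n * (f (k / n) - f ((k + 1 : ℕ) / n)) *
      ((1 - max ((k : ℝ) / n) x) - (1 - max (((k + 1 : ℕ) : ℝ) / n) x))) μ := fun k hk =>
    ((hi k (Finset.mem_range.1 hk).le).sub (hi (k + 1) (Finset.mem_range.1 hk))).const_mul _
  unfold linInterp
  rw [integral_add (integrable_const _) (integrable_finsetSum _ hs), integral_finsetSum _ hs]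
  simp only [integral_const, probReal_univ, one_smul]
  congr 1
  refine Finset.sum_congr rfl fun k hk => ?_
  rw [integral_const_mul, integral_sub (hi k (Finset.mem_range.1 hk).le)
    (hi (k + 1) (Finset.mem_range.1 hk))]
  rfl

lemma tendsto_integral_linInterp {μ : Measure ℝ} [IsProbabilityMeasure μ]
    (hμ : ∀ᵐ x ∂μ, x ∈ Icc (0 : ℝ) 1) {f : ℝ → ℝ} (hf : AntitoneOn f (Icc 0 1))
    (hc : ConcaveOn ℝ (Icc 0 1) f) :
    Filter.Tendsto (fun n : ℕ => ∫ x, linInterp f (n + 1) x ∂μ) Filter.atTop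
      (nhds (∫ x, f x ∂μ)) := by
  refine tendsto_integral_of_dominated_convergence (fun _ => |f 0| + |f 1|) (fun n => ?_)
    (integrable_const _) (fun n => ?_) ?_
  · exact (linInterp_antitone hf _).measurable.aestronglyMeasurable
  · filter_upwards [hμ] with x hx
    have h0 := linInterp_natCast_div f n.succ_pos (Nat.zero_le _)
    have h1 := linInterp_natCast_div f n.succ_pos le_rfl
    rw [div_self (by positivity)] at h1
    rw [Nat.cast_zero, zero_div] at h0
    have h2 := linInterp_antitone hf (n + 1) hx.1
    have h3 := linInterp_antitone hf (n + 1) hx.2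
    rw [Real.norm_eq_abs, abs_le]
    grind
  · filter_upwards [hμ] with x hx
    exact (tendsto_linInterp hf hc hx).comp (Filter.tendsto_add_atTop_nat 1)

/-- Summation by parts: nonnegative nondecreasing weights against the decrements of a
nonnegative sequence ending at `0`. -/
lemma sum_mul_sub_succ_nonneg {a D : ℕ → ℝ} {n : ℕ} (ha : ∀ k < n, 0 ≤ a k)
    (hmono : ∀ k, k + 1 < n → a k ≤ a (k + 1)) (hD : ∀ k ≤ n, 0 ≤ D k) (hDn : D n = 0) :
    0 ≤ ∑ k ∈ Finset.range n, a k * (D k - D (k + 1)) := by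
  have key : ∀ m < n, 0 ≤ ∑ k ∈ Finset.range (m + 1), a k * (D k - D (k + 1)) +
      a m * D (m + 1) := by
    intro m hm
    induction m with
    | zero =>
      have := mul_nonneg (ha 0 hm) (hD 0 hm.le)
      simp only [zero_add, Finset.sum_range_one]
      linarith
    | succ m ih =>
      rw [Finset.sum_range_succ]
      nlinarith [ih (by omega), mul_nonneg (sub_nonneg.2 (hmono m hm)) (hD (m + 1) hm.le)]
  cases n with
  | zero => simp
  | succ n => simpa [hDn] using key n n.lt_succ_self

lemma integral_linInterp_mono {μ ν : Measure ℝ} [IsProbabilityMeasure μ]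
    [IsProbabilityMeasure ν] (hμ : ∀ᵐ x ∂μ, x ∈ Icc (0 : ℝ) 1)
    (hν : ∀ᵐ x ∂ν, x ∈ Icc (0 : ℝ) 1) (h : ∀ z ∈ Icc (0 : ℝ) 1, Lam μ z ≤ Lam ν z)
    {f : ℝ → ℝ} (hf : AntitoneOn f (Icc 0 1)) (hc : ConcaveOn ℝ (Icc 0 1) f)
    {n : ℕ} (hn : 0 < n) :
    ∫ x, linInterp f n x ∂μ ≤ ∫ x, linInterp f n x ∂ν := by
  rw [integral_linInterp hμ, integral_linInterp hν, add_le_add_iff_left, ← sub_nonneg,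
    ← Finset.sum_sub_distrib]
  have hn' : (n : ℝ) ≠ 0 := by positivity
  have key := sum_mul_sub_succ_nonneg (n := n)
    (a := fun k => n * (f (k / n) - f ((k + 1 : ℕ) / n)))
    (D := fun k => Lam ν (k / n) - Lam μ (k / n)) ?_ ?_ ?_ ?_
  · refine key.trans_eq (Finset.sum_congr rfl fun k _ => ?_)
    ring
  · intro k hk
    exact mul_nonneg (by positivity) (sub_nonneg.2 (hf (natCast_div_mem_Icc hk.le)
      (natCast_div_mem_Icc hk) (natCast_div_le_natCast_div k.le_succ)))
  · intro k hk
    have h2 := hc.2 (natCast_div_mem_Icc (show k ≤ n by omega))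
      (natCast_div_mem_Icc (show k + 1 + 1 ≤ n by omega))
      (show (0 : ℝ) ≤ 1 / 2 by norm_num) (show (0 : ℝ) ≤ 1 / 2 by norm_num) (by norm_num)
    have hmid : (1 / 2 : ℝ) • ((k : ℝ) / n) + (1 / 2 : ℝ) • (((k + 1 + 1 : ℕ) : ℝ) / n) =
        ((k + 1 : ℕ) : ℝ) / n := by
      simp only [smul_eq_mul]; push_cast; ring
    rw [hmid] at h2
    simp only [smul_eq_mul] at h2
    refine mul_le_mul_of_nonneg_left ?_ (by positivity)
    linarith
  · intro k hk
    exact sub_nonneg.2 (h _ (natCast_div_mem_Icc hk))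
  · simp [div_self hn', Lam_one hμ, Lam_one hν]

/-- Equivalence of conditions (ii) and (iii) in the characterization of channel
degradation: integrating all nonincreasing concave test functions orders the
measures iff the `Λ` functions are pointwise ordered on `[0,1]`. -/
theorem degradation_characterization
    (μ ν : Measure ℝ) (hμp : IsProbabilityMeasure μ) (hνp : IsProbabilityMeasure ν)
    (hμs : μ (Set.Icc (0:ℝ) 1)ᶜ = 0) (hνs : ν (Set.Icc (0:ℝ) 1)ᶜ = 0) :
    (∀ f : ℝ → ℝ, AntitoneOn f (Set.Icc (0:ℝ) 1) →
        ConcaveOn ℝ (Set.Icc (0:ℝ) 1) f →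
        ∫ x, f x ∂μ ≤ ∫ x, f x ∂ν) ↔
      (∀ z ∈ Set.Icc (0:ℝ) 1, Lam μ z ≤ Lam ν z) := by
  refine ⟨fun h z _ => h _ ?_ ?_, fun h f hf hc => ?_⟩
  · intro x _ y _ hxy
    exact sub_le_sub_left (max_le_max_left z hxy) 1
  · exact (concaveOn_const 1 (convex_Icc 0 1)).sub
      ((convexOn_const z (convex_Icc 0 1)).sup (convexOn_id (convex_Icc 0 1)))
  · have hμ : ∀ᵐ x ∂μ, x ∈ Icc (0 : ℝ) 1 := mem_ae_iff.2 hμs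
    have hν : ∀ᵐ x ∂ν, x ∈ Icc (0 : ℝ) 1 := mem_ae_iff.2 hνs
    exact le_of_tendsto_of_tendsto' (tendsto_integral_linInterp hμ hf hc)
      (tendsto_integral_linInterp hν hf hc)
      fun n => integral_linInterp_mono hμ hν h hf hc n.succ_pos
end

section
/- Let μ and ν be Borel probability measures on [0,1] such that Λ_μ(z) ≤ Λ_ν(z) for every z ∈ [0,1]. Then ∫ h dμ ≤ ∫ h dν, where h(x) = h₂((1-x)/2); that is, a degraded channel has larger entropy (hence lower capacity) than the original channel. -/
open MeasureTheory Real Set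

/-- Binary entropy function (Lean's `logb` satisfies `logb 2 0 = 0`,
so the convention `0·log₂ 0 = 0` is automatic). -/
noncomputable def h2 (p : ℝ) : ℝ := -p * Real.logb 2 p - (1 - p) * Real.logb 2 (1 - p)

/-- `h(x) = h₂((1-x)/2)`. -/
noncomputable def hD (x : ℝ) : ℝ := h2 ((1 - x) / 2)

lemma integral_inv_one_sub_sq {x : ℝ} (h0 : 0 ≤ x) (h1 : x < 1) :
    IntervalIntegrable (fun z : ℝ => 1 / (1 - z ^ 2)) volume 0 x ∧
      ∫ z in (0 : ℝ)..x, 1 / (1 - z ^ 2) = (log (1 + x) - log (1 - x)) / 2 := by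
  have hne : ∀ z ∈ uIcc 0 x, 0 < 1 + z ∧ 0 < 1 - z := by
    intro z hz
    rw [uIcc_of_le h0] at hz
    constructor <;> linarith [hz.1, hz.2]
  have hint : IntervalIntegrable (fun z : ℝ => 1 / (1 - z ^ 2)) volume 0 x := by
    apply ContinuousOn.intervalIntegrable
    apply ContinuousOn.div (by fun_prop) (by fun_prop)
    intro z hz
    nlinarith [mul_pos (hne z hz).1 (hne z hz).2]
  refine ⟨hint, ?_⟩
  have hd : ∀ z ∈ uIcc 0 x,
      HasDerivAt (fun z => (log (1 + z) - log (1 - z)) / 2) (1 / (1 - z ^ 2)) z := by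
    intro z hz
    obtain ⟨hp, hm⟩ := hne z hz
    have hplus := ((hasDerivAt_id' z).const_add 1).log hp.ne'
    have hminus := ((hasDerivAt_id' z).const_sub 1).log hm.ne'
    refine ((hplus.sub hminus).div_const 2).congr_deriv ?_
    rw [show 1 - z ^ 2 = (1 - z) * (1 + z) by ring]
    have hp' := hp.ne'
    have hm' := hm.ne'
    field_simp
    ring
  rw [intervalIntegral.integral_eq_sub_of_hasDerivAt hd hint]
  simp

lemma integral_inv_one_add {x : ℝ} (h0 : 0 ≤ x) (h1 : x ≤ 1) :
    IntervalIntegrable (fun z : ℝ => 1 / (1 + z)) volume x 1 ∧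
      ∫ z in x..1, 1 / (1 + z) = log 2 - log (1 + x) := by
  have hne : ∀ z ∈ uIcc x 1, 1 + z ≠ 0 := by
    intro z hz
    rw [uIcc_of_le h1] at hz
    linarith [hz.1]
  have hint : IntervalIntegrable (fun z : ℝ => 1 / (1 + z)) volume x 1 :=
    (ContinuousOn.div (by fun_prop) (by fun_prop) hne).intervalIntegrable
  refine ⟨hint, ?_⟩
  rw [intervalIntegral.integral_eq_sub_of_hasDerivAt
    (fun z hz => ((hasDerivAt_id' z).const_add 1).log (hne z hz)) hint]
  norm_num

/-- The entropy `h` is a mixture of the functions `x ↦ 1 - max z x`. -/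
lemma log_two_mul_hD {x : ℝ} (hx : x ∈ Icc (0 : ℝ) 1) :
    log 2 * hD x = ∫ z in (0 : ℝ)..1, (1 - max z x) / (1 - z ^ 2) := by
  obtain ⟨h0, h1⟩ := hx
  rcases h1.eq_or_lt with rfl | h1'
  · have : ∫ z in (0 : ℝ)..1, (1 - max z 1) / (1 - z ^ 2) = ∫ z in (0 : ℝ)..1, (0 : ℝ) := by
      apply intervalIntegral.integral_congr
      intro z hz
      rw [uIcc_of_le h0] at hz
      simp [max_eq_right hz.2]
    rw [this]
    simp [hD, h2]
  obtain ⟨ia, ea⟩ := integral_inv_one_sub_sq h0 h1'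
  obtain ⟨ib, eb⟩ := integral_inv_one_add h0 h1
  have ca : EqOn (fun z : ℝ => (1 - x) * (1 / (1 - z ^ 2)))
      (fun z => (1 - max z x) / (1 - z ^ 2)) (uIcc 0 x) := by
    intro z hz
    rw [uIcc_of_le h0] at hz
    simp [max_eq_right hz.2, div_eq_mul_inv]
  have cb : EqOn (fun z : ℝ => 1 / (1 + z))
      (fun z => (1 - max z x) / (1 - z ^ 2)) (Ioo x 1) := by
    intro z hz
    have hp : 1 + z ≠ 0 := by linarith [hz.1]
    have hm : 1 - z ≠ 0 := by linarith [hz.2]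
    simp only [max_eq_left hz.1.le]
    rw [show 1 - z ^ 2 = (1 - z) * (1 + z) by ring]
    field_simp
  have cb' : (fun z : ℝ => 1 / (1 + z)) =ᵐ[volume.restrict (uIoc x 1)]
      (fun z => (1 - max z x) / (1 - z ^ 2)) := by
    rw [uIoc_of_le h1, ← restrict_Ioo_eq_restrict_Ioc]
    exact (ae_restrict_mem measurableSet_Ioo).mono cb
  rw [← intervalIntegral.integral_add_adjacent_intervals
      ((ia.const_mul (1 - x)).congr (ca.mono uIoc_subset_uIcc)) (ib.congr_ae cb'),
    ← intervalIntegral.integral_congr ca,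
    ← intervalIntegral.integral_congr_ae_restrict cb', intervalIntegral.integral_const_mul, ea, eb]
  have hl : log 2 ≠ 0 := (log_pos one_lt_two).ne'
  rw [hD, h2, show 1 - (1 - x) / 2 = (1 + x) / 2 by ring, logb, logb,
    log_div (by linarith) two_ne_zero, log_div (by linarith) two_ne_zero]
  field_simp
  ring

lemma integrable_kernel (μ : Measure ℝ) [IsProbabilityMeasure μ] (hμ : μ (Icc (0 : ℝ) 1)ᶜ = 0) :
    Integrable (fun p : ℝ × ℝ => (1 - max p.2 p.1) / (1 - p.2 ^ 2))
      (μ.prod (volume.restrict (Ioc (0 : ℝ) 1))) := by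
  apply Integrable.of_bound (C := 1)
  · exact Measurable.aestronglyMeasurable (by fun_prop)
  have hx : ∀ᵐ x ∂μ, x ∈ Icc (0 : ℝ) 1 := hμ
  have hz : ∀ᵐ z ∂volume.restrict (Ioc (0 : ℝ) 1), z ∈ Ioc (0 : ℝ) 1 :=
    ae_restrict_mem measurableSet_Ioc
  filter_upwards [Measure.quasiMeasurePreserving_fst.ae hx,
    Measure.quasiMeasurePreserving_snd.ae hz] with p hp hq
  have hmax : max p.2 p.1 ≤ 1 := max_le hq.2 hp.2
  have hsq : 0 ≤ 1 - p.2 ^ 2 := by nlinarith [hq.1, hq.2]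
  rw [norm_eq_abs, abs_of_nonneg (div_nonneg (by linarith) hsq)]
  apply div_le_one_of_le₀ _ hsq
  nlinarith [hq.1, hq.2, le_max_left p.2 p.1]

lemma log_two_mul_integral_hD (μ : Measure ℝ) [IsProbabilityMeasure μ]
    (hμ : μ (Icc (0 : ℝ) 1)ᶜ = 0) :
    log 2 * ∫ x, hD x ∂μ = ∫ z in Ioc (0 : ℝ) 1, Lam μ z / (1 - z ^ 2) := by
  have hx : ∀ᵐ x ∂μ, x ∈ Icc (0 : ℝ) 1 := hμ
  calc log 2 * ∫ x, hD x ∂μ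
      = ∫ x, (∫ z in Ioc (0 : ℝ) 1, (1 - max z x) / (1 - z ^ 2)) ∂μ := by
        rw [← integral_const_mul]
        apply integral_congr_ae
        filter_upwards [hx] with x hx
        rw [log_two_mul_hD hx, intervalIntegral.integral_of_le zero_le_one]
    _ = ∫ z in Ioc (0 : ℝ) 1, (∫ x, (1 - max z x) / (1 - z ^ 2) ∂μ) :=
        integral_integral_swap (integrable_kernel μ hμ)
    _ = _ := by simp only [integral_div, Lam]

lemma integrableOn_Lam_div (μ : Measure ℝ) [IsProbabilityMeasure μ]
    (hμ : μ (Icc (0 : ℝ) 1)ᶜ = 0) :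
    IntegrableOn (fun z => Lam μ z / (1 - z ^ 2)) (Ioc 0 1) := by
  simpa only [integral_div, Lam, IntegrableOn] using (integrable_kernel μ hμ).integral_prod_right

/-- A degraded channel has larger entropy (hence lower capacity) than the
original channel. -/
theorem entropy_le_of_degraded
    (μ ν : Measure ℝ) (hμp : IsProbabilityMeasure μ) (hνp : IsProbabilityMeasure ν)
    (hμs : μ (Set.Icc (0:ℝ) 1)ᶜ = 0) (hνs : ν (Set.Icc (0:ℝ) 1)ᶜ = 0)
    (hdeg : ∀ z ∈ Set.Icc (0:ℝ) 1, Lam μ z ≤ Lam ν z) :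
    ∫ x, hD x ∂μ ≤ ∫ x, hD x ∂ν := by
  apply le_of_mul_le_mul_left _ (log_pos one_lt_two)
  rw [log_two_mul_integral_hD μ hμs, log_two_mul_integral_hD ν hνs]
  apply setIntegral_mono_on (integrableOn_Lam_div μ hμs) (integrableOn_Lam_div ν hνs)
    measurableSet_Ioc
  intro z hz
  have hsq : 0 ≤ 1 - z ^ 2 := by nlinarith [hz.1, hz.2]
  exact div_le_div_of_nonneg_right (hdeg z ⟨hz.1.le, hz.2⟩) hsq
end

section
/- Fix c with 0 < c < 1 and let ε_bsc ∈ (0,1/2) solve 1 - h₂(ε_bsc) = c. For every z ∈ [0, 1-2ε_bsc) and every Borel probability measure μ on [0,1] with ∫ h dμ = 1 - c, one has Λ_μ(z) ≤ (1-c)(1-z)/h(z). -/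
open MeasureTheory Real Set

/-- `hD` is a rescaled natural-logarithm binary entropy. -/
lemma hD_eq_binEntropy_div_log_two (x : ℝ) :
    hD x = binEntropy ((1 - x) / 2) / log 2 := by
  rw [binEntropy_eq_negMulLog_add_negMulLog_one_sub]
  simp only [hD, h2, logb, negMulLog]
  ring

lemma mul_binEntropy_le_mul_binEntropy {p q : ℝ} (hp : 0 ≤ p) (hpq : p ≤ q) (hq : q ≤ 1) :
    p * binEntropy q ≤ q * binEntropy p := by
  rcases hp.eq_or_lt with rfl | hp0
  · simp
  have hq0 : 0 < q := hp0.trans_le hpq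
  have ha : 0 ≤ p / q := by positivity
  have hb : 0 ≤ 1 - p / q := sub_nonneg.2 ((div_le_one hq0).2 hpq)
  have hconc := strictConcave_binEntropy.concaveOn.2 ⟨hq0.le, hq⟩
    ⟨le_rfl, zero_le_one⟩ ha hb (add_sub_cancel _ _)
  simp only [smul_eq_mul, binEntropy_zero, mul_zero, add_zero, div_mul_cancel₀ _ hq0.ne'] at hconc
  calc p * binEntropy q = q * (p / q * binEntropy q) := by field_simp
    _ ≤ q * binEntropy p := mul_le_mul_of_nonneg_left hconc hq0.le

lemma hD_pos {z : ℝ} (hz0 : 0 ≤ z) (hz1 : z < 1) : 0 < hD z := by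
  rw [hD_eq_binEntropy_div_log_two]
  exact div_pos (binEntropy_pos (by linarith) (by linarith)) (log_pos one_lt_two)

lemma one_sub_max_mul_hD_le {z x : ℝ} (hz0 : 0 ≤ z) (hz1 : z ≤ 1) (hx : x ∈ Icc (0 : ℝ) 1) :
    (1 - max z x) * hD z ≤ (1 - z) * hD x := by
  obtain ⟨hx0, hx1⟩ := hx
  have hlog : 0 < log 2 := log_pos one_lt_two
  simp only [hD_eq_binEntropy_div_log_two, ← mul_div_assoc]
  refine div_le_div_of_nonneg_right ?_ hlog.le
  rcases le_total x z with hxz | hzx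
  · rw [max_eq_left hxz]
    refine mul_le_mul_of_nonneg_left ?_ (by linarith)
    exact binEntropy_strictMonoOn.monotoneOn ⟨by linarith, by linarith⟩
      ⟨by linarith, by linarith⟩ (by linarith)
  · rw [max_eq_right hzx]
    have key := mul_binEntropy_le_mul_binEntropy (p := (1 - x) / 2) (q := (1 - z) / 2)
      (by linarith) (by linarith) (by linarith)
    linarith

/-- For `z ∈ [0, 1-2ε_bsc)` and every channel in `BMS(c)`,
`Λ_μ(z) ≤ (1-c)(1-z)/h(z)`. -/
theorem Lam_le_upper_bound
    (c ε : ℝ) (hc0 : 0 < c) (hc1 : c < 1)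
    (hε0 : 0 < ε) (hε1 : ε < 1 / 2) (hεc : 1 - h2 ε = c)
    (z : ℝ) (hz0 : 0 ≤ z) (hz1 : z < 1 - 2 * ε)
    (μ : Measure ℝ) (hprob : IsProbabilityMeasure μ)
    (hsupp : μ (Set.Icc (0:ℝ) 1)ᶜ = 0)
    (hcap : ∫ x, hD x ∂μ = 1 - c) :
    Lam μ z ≤ (1 - c) * (1 - z) / hD z := by
  have hz : z < 1 := by linarith
  have hmem : ∀ᵐ x ∂μ, x ∈ Icc (0 : ℝ) 1 := hsupp
  have hint : Integrable hD μ := .of_integral_ne_zero (by rw [hcap]; linarith)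
  have hintmax : Integrable (fun x => 1 - max z x) μ := by
    refine .of_bound (by fun_prop) 1 ?_
    filter_upwards [hmem] with x hx
    rw [norm_eq_abs, abs_le]
    have hle : max z x ≤ 1 := max_le hz.le hx.2
    have hge : z ≤ max z x := le_max_left z x
    constructor <;> linarith
  rw [le_div_iff₀ (hD_pos hz0 hz), Lam, ← integral_mul_const, ← hcap, mul_comm (∫ x, hD x ∂μ),
    ← integral_const_mul]
  refine integral_mono_ae (hintmax.mul_const _) (hint.const_mul _) ?_
  filter_upwards [hmem] with x hx
  exact one_sub_max_mul_hD_le hz0 hz.le hx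
end

section
/- Fix c with 0 < c < 1 and let ε_bsc ∈ (0,1/2) solve 1 - h₂(ε_bsc) = c. For every z ∈ [0,1], the supremum over μ ∈ BMS(c) of Λ_μ(z) is attained and equals Λ̄(z), where Λ̄(z) = (1-c)(1-z)/h(z) if z ∈ [0, 1-2ε_bsc), and Λ̄(z) = 1-z if z ∈ [1-2ε_bsc, 1]. In particular, for z ∈ [1-2ε_bsc,1] the supremum is attained by the Dirac measure δ_{1-2ε_bsc}, and for z ∈ [0, 1-2ε_bsc) it is attained by the measure placing mass (1-c)/h(z) at z and mass 1-(1-c)/h(z) at 1. -/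
open MeasureTheory Real Set

/-- Membership in the family `BMS(c)`: Borel probability measures on `[0,1]`
with `∫ h dμ = 1 - c`. -/
def memBMS (c : ℝ) (μ : Measure ℝ) : Prop :=
  IsProbabilityMeasure μ ∧ μ (Set.Icc (0:ℝ) 1)ᶜ = 0 ∧ ∫ x, hD x ∂μ = 1 - c

theorem h2_eq_binEntropy_div (p : ℝ) : h2 p = binEntropy p / Real.log 2 := by
  simp only [h2, Real.logb, binEntropy_eq_negMulLog_add_negMulLog_one_sub, negMulLog]
  ring

theorem log_two_pos : 0 < Real.log 2 := Real.log_pos one_lt_two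

theorem h2_zero : h2 0 = 0 := by simp [h2_eq_binEntropy_div]

theorem h2_monotoneOn : MonotoneOn h2 (Icc 0 (1 / 2)) := by
  intro a ha b hb hab
  rw [h2_eq_binEntropy_div, h2_eq_binEntropy_div]
  rw [one_div] at ha hb
  exact div_le_div_of_nonneg_right (binEntropy_strictMonoOn.monotoneOn ha hb hab) log_two_pos.le

theorem continuous_hD : Continuous hD := by
  have : hD = fun x => binEntropy ((1 - x) / 2) / Real.log 2 :=
    funext fun x => h2_eq_binEntropy_div _
  rw [this]
  fun_prop

theorem hD_one : hD 1 = 0 := by simp [hD, h2_zero]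

theorem hD_one_sub_two_mul (ε : ℝ) : hD (1 - 2 * ε) = h2 ε := by
  rw [hD]
  congr 1
  ring

theorem hD_antitoneOn : AntitoneOn hD (Icc 0 1) := fun x hx y hy hxy =>
  h2_monotoneOn ⟨by linarith [hy.2], by linarith [hy.1]⟩ ⟨by linarith [hx.2], by linarith [hx.1]⟩
    (by linarith)

theorem one_sub_mul_hD_le {x z : ℝ} (hz : 0 ≤ z) (hzx : z ≤ x) (hx : x ≤ 1) (hz1 : z < 1) :
    (1 - x) * hD z ≤ (1 - z) * hD x := by
  have hpos : 0 < 1 - z := by linarith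
  have key := strictConcave_binEntropy.concaveOn.2
    (show (1 - z) / 2 ∈ Icc (0 : ℝ) 1 from ⟨by linarith, by linarith⟩)
    (left_mem_Icc.2 zero_le_one)
    (show 0 ≤ (1 - x) / (1 - z) from div_nonneg (by linarith) hpos.le)
    (show 0 ≤ (x - z) / (1 - z) from div_nonneg (by linarith) hpos.le)
    (by field_simp; ring)
  have hpt : (1 - x) / (1 - z) * ((1 - z) / 2) = (1 - x) / 2 := by field_simp
  simp only [smul_eq_mul, binEntropy_zero, mul_zero, add_zero, hpt] at key
  rw [div_mul_eq_mul_div, div_le_iff₀ hpos] at key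
  rw [hD, hD, h2_eq_binEntropy_div, h2_eq_binEntropy_div, ← mul_div_assoc, ← mul_div_assoc]
  exact div_le_div_of_nonneg_right (by linarith) log_two_pos.le

theorem one_sub_max_le_hD {x z : ℝ} (hx : x ∈ Icc (0 : ℝ) 1) (hz : z ∈ Icc (0 : ℝ) 1)
    (hz1 : z < 1) (hpos : 0 < hD z) : 1 - max z x ≤ (1 - z) / hD z * hD x := by
  rw [div_mul_eq_mul_div, le_div_iff₀ hpos]
  rcases le_total z x with h | h
  · rw [max_eq_right h]
    exact one_sub_mul_hD_le hz.1 h hx.2 hz1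
  · rw [max_eq_left h]
    exact mul_le_mul_of_nonneg_left (hD_antitoneOn hx hz h) (by linarith)

theorem ae_mem_Icc_of_memBMS {c : ℝ} {μ : Measure ℝ} (hμ : memBMS c μ) :
    ∀ᵐ x ∂μ, x ∈ Icc (0 : ℝ) 1 := mem_ae_iff.2 hμ.2.1

theorem integrable_of_memBMS {c : ℝ} {μ : Measure ℝ} (hμ : memBMS c μ) {f : ℝ → ℝ}
    (hf : Continuous f) : Integrable f μ := by
  have := hμ.1
  obtain ⟨C, hC⟩ := (isCompact_Icc (a := (0 : ℝ)) (b := 1)).exists_bound_of_continuousOn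
    hf.continuousOn
  refine Integrable.of_bound hf.aestronglyMeasurable C ?_
  filter_upwards [ae_mem_Icc_of_memBMS hμ] with x hx using hC x hx

theorem Lam_le_one_sub {c : ℝ} {μ : Measure ℝ} (hμ : memBMS c μ) (z : ℝ) :
    Lam μ z ≤ 1 - z := by
  have := hμ.1
  calc Lam μ z ≤ ∫ _, (1 - z) ∂μ :=
        integral_mono (integrable_of_memBMS hμ (by fun_prop)) (integrable_const _)
          fun x => sub_le_sub_left (le_max_left z x) 1
    _ = 1 - z := by simp

theorem Lam_le_of_hD_pos {c z : ℝ} {μ : Measure ℝ} (hμ : memBMS c μ) (hz : z ∈ Icc (0 : ℝ) 1)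
    (hz1 : z < 1) (hpos : 0 < hD z) : Lam μ z ≤ (1 - c) * (1 - z) / hD z := by
  calc Lam μ z ≤ ∫ x, (1 - z) / hD z * hD x ∂μ :=
        integral_mono_ae (integrable_of_memBMS hμ (by fun_prop))
          ((integrable_of_memBMS hμ continuous_hD).const_mul _) (by
            filter_upwards [ae_mem_Icc_of_memBMS hμ] with x hx
              using one_sub_max_le_hD hx hz hz1 hpos)
    _ = (1 - c) * (1 - z) / hD z := by
        rw [integral_const_mul, hμ.2.2]
        ring

theorem memBMS_dirac {x : ℝ} (hx : x ∈ Icc (0 : ℝ) 1) :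
    memBMS (1 - hD x) (Measure.dirac x) := by
  refine ⟨inferInstance, ?_, by simp⟩
  rw [Measure.dirac_apply' _ measurableSet_Icc.compl]
  simpa using hx

theorem integral_two_point {a b x y : ℝ} (ha : 0 ≤ a) (hb : 0 ≤ b) (f : ℝ → ℝ) :
    ∫ t, f t ∂(ENNReal.ofReal a • Measure.dirac x + ENNReal.ofReal b • Measure.dirac y) =
      a * f x + b * f y := by
  rw [integral_add_measure
    ((integrable_dirac enorm_lt_top).smul_measure ENNReal.ofReal_ne_top)
    ((integrable_dirac enorm_lt_top).smul_measure ENNReal.ofReal_ne_top)]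
  simp [ENNReal.toReal_ofReal ha, ENNReal.toReal_ofReal hb]

theorem memBMS_two_point {a z : ℝ} (ha : 0 ≤ a) (ha1 : a ≤ 1) (hz : z ∈ Icc (0 : ℝ) 1) :
    memBMS (1 - a * hD z)
      (ENNReal.ofReal a • Measure.dirac z + ENNReal.ofReal (1 - a) • Measure.dirac 1) := by
  have hb : 0 ≤ 1 - a := sub_nonneg.2 ha1
  refine ⟨⟨?_⟩, ?_, ?_⟩
  · simp [← ENNReal.ofReal_add ha hb]
  · have hz_null := (memBMS_dirac hz).2.1
    have one_null := (memBMS_dirac (right_mem_Icc.2 (zero_le_one' ℝ))).2.1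
    rw [Measure.add_apply, Measure.smul_apply, Measure.smul_apply, hz_null, one_null]
    simp
  · rw [integral_two_point ha hb, hD_one]
    ring

theorem Lam_two_point {a z : ℝ} (ha : 0 ≤ a) (ha1 : a ≤ 1) (hz : z ≤ 1) :
    Lam (ENNReal.ofReal a • Measure.dirac z + ENNReal.ofReal (1 - a) • Measure.dirac 1) z =
      a * (1 - z) := by
  rw [Lam, integral_two_point ha (sub_nonneg.2 ha1), max_self, max_eq_right hz]
  ring

/-- The pointwise maximum `Λ̄(z)` of `Λ_μ(z)` over `μ ∈ BMS(c)` is attained and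
equals `(1-c)(1-z)/h(z)` on `[0, 1-2ε_bsc)` and `1-z` on `[1-2ε_bsc, 1]`;
it is attained by `δ_{1-2ε_bsc}` in the second regime, and by the measure with
mass `(1-c)/h(z)` at `z` and mass `1-(1-c)/h(z)` at `1` in the first regime. -/
theorem Lam_pointwise_max
    (c ε : ℝ) (hc0 : 0 < c) (hc1 : c < 1)
    (hε0 : 0 < ε) (hε1 : ε < 1 / 2) (hεc : 1 - h2 ε = c)
    (z : ℝ) (hz : z ∈ Set.Icc (0:ℝ) 1) :
    IsGreatest {r : ℝ | ∃ μ : Measure ℝ, memBMS c μ ∧ Lam μ z = r}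
        (if z < 1 - 2 * ε then (1 - c) * (1 - z) / hD z else 1 - z) ∧
      (1 - 2 * ε ≤ z →
        memBMS c (Measure.dirac (1 - 2 * ε)) ∧
          Lam (Measure.dirac (1 - 2 * ε)) z = 1 - z) ∧
      (z < 1 - 2 * ε →
        memBMS c (ENNReal.ofReal ((1 - c) / hD z) • Measure.dirac z +
            ENNReal.ofReal (1 - (1 - c) / hD z) • Measure.dirac 1) ∧
          Lam (ENNReal.ofReal ((1 - c) / hD z) • Measure.dirac z +
              ENNReal.ofReal (1 - (1 - c) / hD z) • Measure.dirac 1) z =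
            (1 - c) * (1 - z) / hD z) := by
  have hεmem : 1 - 2 * ε ∈ Icc (0 : ℝ) 1 := ⟨by linarith, by linarith⟩
  have hDε : hD (1 - 2 * ε) = 1 - c := by rw [hD_one_sub_two_mul]; linarith
  have high : 1 - 2 * ε ≤ z → memBMS c (Measure.dirac (1 - 2 * ε)) ∧
      Lam (Measure.dirac (1 - 2 * ε)) z = 1 - z := by
    intro hle
    refine ⟨?_, by simp [Lam, max_eq_left hle]⟩
    have h := memBMS_dirac hεmem
    rwa [hDε, sub_sub_cancel] at h
  have hDz : z < 1 - 2 * ε → 1 - c ≤ hD z := fun hlt =>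
    hDε ▸ hD_antitoneOn hz hεmem hlt.le
  have low : z < 1 - 2 * ε →
      memBMS c (ENNReal.ofReal ((1 - c) / hD z) • Measure.dirac z +
          ENNReal.ofReal (1 - (1 - c) / hD z) • Measure.dirac 1) ∧
        Lam (ENNReal.ofReal ((1 - c) / hD z) • Measure.dirac z +
            ENNReal.ofReal (1 - (1 - c) / hD z) • Measure.dirac 1) z =
          (1 - c) * (1 - z) / hD z := by
    intro hlt
    have hpos : 0 < hD z := by linarith [hDz hlt]
    have ha : 0 ≤ (1 - c) / hD z := div_nonneg (by linarith) hpos.le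
    have ha1 : (1 - c) / hD z ≤ 1 := (div_le_one hpos).2 (hDz hlt)
    refine ⟨?_, ?_⟩
    · have h := memBMS_two_point ha ha1 hz
      rwa [div_mul_cancel₀ _ hpos.ne', sub_sub_cancel] at h
    · rw [Lam_two_point ha ha1 hz.2]
      ring
  refine ⟨?_, high, low⟩
  split_ifs with hlt
  · refine ⟨⟨_, low hlt⟩, ?_⟩
    rintro _ ⟨μ, hμ, rfl⟩
    exact Lam_le_of_hD_pos hμ hz (by linarith) (by linarith [hDz hlt])
  · refine ⟨⟨_, high (not_lt.1 hlt)⟩, ?_⟩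
    rintro _ ⟨μ, hμ, rfl⟩
    exact Lam_le_one_sub hμ z
end

section
/- Fix c with 0 < c < 1 and let ε_bsc ∈ (0,1/2) solve 1 - h₂(ε_bsc) = c. Then (1/ln 2) · ∫₀¹ Λ*(z)/(1-z²) dz = 1 - c²/(1-2ε_bsc); that is, the capacity of the least degraded channel with respect to the family BMS(c) equals C* = c²/(1-2ε_bsc) bits per channel use. -/
open MeasureTheory Real Set

/-- `Λ*(z)`, characterizing the least degraded channel. -/
noncomputable def Lstar (c ε z : ℝ) : ℝ :=
  if z < 1 - 2 * ε then (1 - c) - ((1 - c - 2 * ε) / (1 - 2 * ε)) * z else 1 - z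

lemma intervalIntegrable_and_integral_linear_div_one_sub_sq (A B : ℝ) {a : ℝ}
    (ha0 : 0 ≤ a) (ha1 : a < 1) :
    IntervalIntegrable (fun z : ℝ => (A - B * z) / (1 - z ^ 2)) volume 0 a ∧
      ∫ z in (0:ℝ)..a, (A - B * z) / (1 - z ^ 2) =
        (A + B) / 2 * Real.log (1 + a) - (A - B) / 2 * Real.log (1 - a) := by
  have hint : IntervalIntegrable (fun z : ℝ => (A - B * z) / (1 - z ^ 2)) volume 0 a := by
    apply ContinuousOn.intervalIntegrable
    apply ContinuousOn.div (by fun_prop) (by fun_prop)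
    intro z hz
    rw [uIcc_of_le ha0] at hz
    nlinarith [hz.1, hz.2]
  refine ⟨hint, ?_⟩
  rw [intervalIntegral.integral_eq_sub_of_hasDerivAt
    (f := fun z => (A + B) / 2 * Real.log (1 + z) - (A - B) / 2 * Real.log (1 - z)) ?_ hint]
  · simp
  · intro z hz
    rw [uIcc_of_le ha0] at hz
    have h1 : 1 + z ≠ 0 := by linarith [hz.1]
    have hsub : 1 - z ≠ 0 := by linarith [hz.2]
    have h3 : 1 - z ^ 2 ≠ 0 := by
      rw [show 1 - z ^ 2 = (1 + z) * (1 - z) by ring]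
      exact mul_ne_zero h1 hsub
    have hd := ((((hasDerivAt_id z).const_add 1).log h1).const_mul ((A + B) / 2)).sub
      ((((hasDerivAt_id z).const_sub 1).log hsub).const_mul ((A - B) / 2))
    refine hd.congr_deriv ?_
    simp only [id]
    rw [show 1 - z ^ 2 = (1 + z) * (1 - z) by ring]
    field_simp
    ring

lemma intervalIntegrable_and_integral_inv_one_add {a b : ℝ} (ha : -1 < a) (hab : a ≤ b) :
    IntervalIntegrable (fun z : ℝ => (1 + z)⁻¹) volume a b ∧
      ∫ z in a..b, (1 + z)⁻¹ = Real.log (1 + b) - Real.log (1 + a) := by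
  have hpos : ∀ z ∈ uIcc a b, 1 + z ≠ 0 := by
    intro z hz
    rw [uIcc_of_le hab] at hz
    linarith [hz.1]
  have hint : IntervalIntegrable (fun z : ℝ => (1 + z)⁻¹) volume a b :=
    (ContinuousOn.inv₀ (by fun_prop) hpos).intervalIntegrable
  refine ⟨hint, ?_⟩
  rw [intervalIntegral.integral_eq_sub_of_hasDerivAt (f := fun z => Real.log (1 + z)) ?_ hint]
  intro z hz
  refine (((hasDerivAt_id z).const_add 1).log (hpos z hz)).congr_deriv ?_
  simp

/-- The capacity of the least degraded channel with respect to `BMS(c)` equals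
`C* = c²/(1-2ε_bsc)`: `(1/ln 2)·∫₀¹ Λ*(z)/(1-z²) dz = 1 - c²/(1-2ε_bsc)`. -/
theorem capacity_least_degraded
    (c ε : ℝ) (hc0 : 0 < c) (hc1 : c < 1)
    (hε0 : 0 < ε) (hε1 : ε < 1 / 2) (hεc : 1 - h2 ε = c) :
    (1 / Real.log 2) * ∫ z in (0:ℝ)..1, Lstar c ε z / (1 - z ^ 2) =
      1 - c ^ 2 / (1 - 2 * ε) := by
  have hl : 0 < Real.log 2 := Real.log_pos (by norm_num)
  have ha : 0 < 1 - 2 * ε := by linarith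
  obtain ⟨hi1, he1⟩ := intervalIntegrable_and_integral_linear_div_one_sub_sq (1 - c)
    ((1 - c - 2 * ε) / (1 - 2 * ε)) ha.le (by linarith)
  obtain ⟨hi2, he2⟩ := intervalIntegrable_and_integral_inv_one_add
    (a := 1 - 2 * ε) (b := 1) (by linarith) (by linarith)
  have hc₁ : EqOn (fun z : ℝ => (1 - c - (1 - c - 2 * ε) / (1 - 2 * ε) * z) / (1 - z ^ 2))
      (fun z => Lstar c ε z / (1 - z ^ 2)) (uIoo 0 (1 - 2 * ε)) := by
    intro z hz
    rw [uIoo_of_le ha.le] at hz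
    simp [Lstar, hz.2]
  have hc₂ : EqOn (fun z : ℝ => (1 + z)⁻¹)
      (fun z => Lstar c ε z / (1 - z ^ 2)) (uIoo (1 - 2 * ε) 1) := by
    intro z hz
    rw [uIoo_of_le (by linarith)] at hz
    have h1 : 1 + z ≠ 0 := by linarith [hz.1]
    have hsub : 1 - z ≠ 0 := by linarith [hz.2]
    simp only [Lstar, if_neg hz.1.not_gt]
    rw [show 1 - z ^ 2 = (1 + z) * (1 - z) by ring]
    field_simp
  rw [← intervalIntegral.integral_add_adjacent_intervals (hi1.congr_uIoo hc₁)
    (hi2.congr_uIoo hc₂), ← intervalIntegral.integral_congr_uIoo hc₁,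
    ← intervalIntegral.integral_congr_uIoo hc₂, he1, he2,
    show 1 + (1 - 2 * ε) = 2 * (1 - ε) by ring, show 1 - (1 - 2 * ε) = 2 * ε by ring,
    Real.log_mul two_ne_zero (by linarith), Real.log_mul two_ne_zero hε0.ne',
    show (1 : ℝ) + 1 = 2 by norm_num]
  have key : (1 - ε) * Real.log (1 - ε) = c * Real.log 2 - Real.log 2 - ε * Real.log ε := by
    rw [← hεc, h2, Real.logb, Real.logb]
    field_simp
    ring
  field_simp
  linear_combination (-2 * c) * key
end

section
/- Fix c with 0 < c < 1 and let ε_bsc ∈ (0,1/2) solve 1 - h₂(ε_bsc) = c. Every Borel probability measure μ on [0,1] with ∫ h dμ = 1 - c satisfies μ([1-2ε_bsc, 1]) > 0; in particular, for a discrete such measure with atoms at 0 ≤ x₁ < x₂ < ⋯ < xₙ ≤ 1, the largest atom position satisfies 1-2ε_bsc ≤ xₙ ≤ 1. -/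
open MeasureTheory Real Set

theorem h2_eq_binEntropy_div_log_two (p : ℝ) : h2 p = Real.binEntropy p / Real.log 2 := by
  simp only [h2, Real.binEntropy, Real.logb, Real.log_inv]
  ring

theorem h2_strictMonoOn : StrictMonoOn h2 (Set.Icc 0 2⁻¹) := by
  intro p hp q hq hpq
  simp only [h2_eq_binEntropy_div_log_two]
  exact div_lt_div_of_pos_right (Real.binEntropy_strictMonoOn hp hq hpq)
    (Real.log_pos one_lt_two)

theorem hD_strictAntiOn : StrictAntiOn hD (Set.Icc 0 1) := by
  intro x hx y hy hxy
  exact h2_strictMonoOn ⟨by linarith [hy.2], by linarith [hy.1]⟩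
    ⟨by linarith [hx.2], by linarith [hx.1]⟩ (by linarith)

theorem integrable_hD {μ : Measure ℝ} [IsFiniteMeasure μ]
    (hμ : ∀ᵐ x ∂μ, x ∈ Set.Icc (0 : ℝ) 1) : Integrable hD μ := by
  obtain ⟨C, hC⟩ := isCompact_Icc.exists_bound_of_continuousOn
    (continuous_hD.continuousOn (s := Set.Icc (0 : ℝ) 1))
  exact Integrable.of_bound continuous_hD.aestronglyMeasurable C
    (hμ.mono fun x hx => hC x hx)

/-- Every channel in `BMS(c)` puts positive mass on `[1-2ε_bsc, 1]`; in
particular, for a discrete such channel with atoms at `x₀ < x₁ < ⋯ < xₙ` in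
`[0,1]`, the largest atom position satisfies `1-2ε_bsc ≤ xₙ ≤ 1`. -/
theorem mass_on_upper_interval
    (c ε : ℝ) (hc0 : 0 < c) (hc1 : c < 1)
    (hε0 : 0 < ε) (hε1 : ε < 1 / 2) (hεc : 1 - h2 ε = c) :
    (∀ μ : Measure ℝ, IsProbabilityMeasure μ → μ (Set.Icc (0:ℝ) 1)ᶜ = 0 →
      (∫ x, hD x ∂μ) = 1 - c → 0 < μ (Set.Icc (1 - 2 * ε) 1)) ∧
    (∀ (n : ℕ) (x : Fin (n + 1) → ℝ) (α : Fin (n + 1) → ℝ),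
      StrictMono x → (∀ i, x i ∈ Set.Icc (0:ℝ) 1) → (∀ i, 0 < α i) →
      (∑ i, α i) = 1 → (∑ i, α i * hD (x i)) = 1 - c →
      1 - 2 * ε ≤ x (Fin.last n) ∧ x (Fin.last n) ≤ 1) := by
  have hD_gt : ∀ x, 0 ≤ x → x < 1 - 2 * ε → 1 - c < hD x := by
    intro x hx0 hx1
    have h := hD_strictAntiOn (a := x) (b := 1 - 2 * ε) ⟨hx0, by linarith⟩
      ⟨by linarith, by linarith⟩ hx1
    have h_eps : hD (1 - 2 * ε) = h2 ε := by
      unfold hD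
      congr 1
      ring
    linarith
  refine ⟨fun μ _ hμ hint => ?_, fun n x α hx hx01 hα hsum hint =>
    ⟨?_, (hx01 (Fin.last n)).2⟩⟩
  · rw [pos_iff_ne_zero]
    intro h_zero
    have h_mem : ∀ᵐ x ∂μ, x ∈ Set.Icc (0 : ℝ) 1 := hμ
    have h_lt : ∀ᵐ x ∂μ, 1 - c < hD x := by
      filter_upwards [h_mem, measure_eq_zero_iff_ae_notMem.mp h_zero] with x hx hx'
      exact hD_gt x hx.1 (lt_of_not_ge fun h => hx' ⟨h, hx.2⟩)
    have hD_int := integrable_hD h_mem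
    have h_diff : ∫ x, (hD x - (1 - c)) ∂μ = 0 := by
      rw [integral_sub hD_int (integrable_const _), hint]
      simp
    rw [integral_eq_zero_iff_of_nonneg_ae
      (h_lt.mono fun x hx => (sub_pos.mpr hx).le)
      (hD_int.sub (integrable_const _))] at h_diff
    obtain ⟨x, hx, hx'⟩ := (h_lt.and h_diff).exists
    exact (sub_pos.mpr hx).ne' hx'
  · by_contra! h_last
    have h_sum : ∑ i, α i * (1 - c) < ∑ i, α i * hD (x i) :=
      Finset.sum_lt_sum_of_nonempty Finset.univ_nonempty fun i _ =>
        mul_lt_mul_of_pos_left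
          (hD_gt _ (hx01 i).1 ((hx.monotone (Fin.le_last i)).trans_lt h_last)) (hα i)
    rw [← Finset.sum_mul, hsum, hint, one_mul] at h_sum
    exact h_sum.false
end

section
/- Fix c with 0 < c < 1, let z ∈ [0,1], and let μ be a finitely supported Borel probability measure on [0,1] with ∫ h dμ = 1 - c whose support contains two distinct points x₋ < x₊ both lying in [z,1]. Then μ does not achieve the minimum of Λ_·(z) over the family: there exists a Borel probability measure ν on [0,1] with ∫ h dν = 1 - c and Λ_ν(z) < Λ_μ(z). Consequently, any minimizer of Λ_·(z) over BMS(c) has at most one probability mass on [z,1]. -/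
open MeasureTheory Real Set

theorem hD_eq_binEntropy (x : ℝ) : hD x = Real.binEntropy ((1 - x) / 2) / Real.log 2 := by
  simp only [hD, h2, Real.logb, Real.binEntropy, Real.log_inv]
  ring

theorem strictConcaveOn_hD : StrictConcaveOn ℝ (Icc (0 : ℝ) 1) hD := by
  have hlog : 0 < Real.log 2 := Real.log_pos one_lt_two
  refine ⟨convex_Icc 0 1, fun x hx y hy hxy a b ha hb hab => ?_⟩
  have hx' : (1 - x) / 2 ∈ Icc (0 : ℝ) 1 := ⟨by linarith [hx.2], by linarith [hx.1]⟩
  have hy' : (1 - y) / 2 ∈ Icc (0 : ℝ) 1 := ⟨by linarith [hy.2], by linarith [hy.1]⟩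
  have h := Real.strictConcave_binEntropy.2 hx' hy'
    (fun h => hxy (by linarith)) ha hb hab
  simp only [smul_eq_mul, hD_eq_binEntropy] at h ⊢
  have e : a * ((1 - x) / 2) + b * ((1 - y) / 2) = (1 - (a * x + b * y)) / 2 := by
    linear_combination hab / 2
  rw [e] at h
  rw [← mul_div_assoc, ← mul_div_assoc, ← add_div]
  gcongr

theorem strictAntiOn_hD : StrictAntiOn hD (Icc (0 : ℝ) 1) := by
  have hlog : 0 < Real.log 2 := Real.log_pos one_lt_two
  intro x hx y hy hxy
  have h := Real.binEntropy_strictMonoOn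
    (a := (1 - y) / 2) (b := (1 - x) / 2)
    ⟨by linarith [hy.2], by linarith [hy.1]⟩ ⟨by linarith [hx.2], by linarith [hx.1]⟩
    (by linarith)
  simp only [hD_eq_binEntropy]
  gcongr

/-- Two weighted points of `[0,1]` can be merged into one, keeping total weight and weighted
entropy, at a point strictly above their barycenter. -/
theorem exists_merge_hD {a b p q : ℝ} (ha : 0 ≤ a) (hab : a < b) (hb : b ≤ 1)
    (hp : 0 < p) (hq : 0 < q) :
    ∃ y ∈ Icc a b, (p + q) * hD y = p * hD a + q * hD b ∧ p * a + q * b < (p + q) * y := by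
  have hw : 0 < p + q := by positivity
  have ha' : a ∈ Icc (0 : ℝ) 1 := ⟨ha, by linarith⟩
  have hb' : b ∈ Icc (0 : ℝ) 1 := ⟨by linarith, hb⟩
  have hsum : p / (p + q) + q / (p + q) = 1 := by field_simp
  have hconc := strictConcaveOn_hD.2 ha' hb' hab.ne (div_pos hp hw) (div_pos hq hw) hsum
  have hanti := strictAntiOn_hD ha' hb' hab
  simp only [smul_eq_mul] at hconc
  set m := p / (p + q) * a + q / (p + q) * b with hm
  have hm' : (p + q) * m = p * a + q * b := by rw [hm]; field_simp
  have ham : a < m := by nlinarith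
  have hmb : m < b := by nlinarith
  set t := p / (p + q) * hD a + q / (p + q) * hD b with ht
  have ht' : (p + q) * t = p * hD a + q * hD b := by rw [ht]; field_simp
  have hbt : hD b ≤ t := by nlinarith
  obtain ⟨y, hy, hyt⟩ := intermediate_value_Icc' hmb.le continuous_hD.continuousOn
    ⟨hbt, hconc.le⟩
  have hmy : m < y := by
    refine lt_of_le_of_ne hy.1 fun h => ?_
    rw [h, hyt] at hconc
    exact lt_irrefl _ hconc
  exact ⟨y, ⟨ham.le.trans hy.1, hy.2⟩, by rw [hyt, ht'], by nlinarith⟩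

theorem integrable_of_compl_finset_null {μ : Measure ℝ} [IsFiniteMeasure μ] {s : Finset ℝ}
    (hs : μ (s : Set ℝ)ᶜ = 0) (f : ℝ → ℝ) : Integrable f μ := by
  have h : IntegrableOn f (s : Set ℝ) μ := IntegrableOn.finset
  rwa [IntegrableOn, Measure.restrict_eq_self_of_ae_mem (show ∀ᵐ x ∂μ, x ∈ (s : Set ℝ) from hs)]
    at h

theorem setIntegral_compl_pair {μ : Measure ℝ} [IsFiniteMeasure μ] {f : ℝ → ℝ}
    (hf : Integrable f μ) {a b : ℝ} (hab : a ≠ b) :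
    ∫ x, f x ∂μ = ∫ x in ({a, b} : Set ℝ)ᶜ, f x ∂μ + (μ.real {a} * f a + μ.real {b} * f b) := by
  have hm : MeasurableSet ({a, b} : Set ℝ) := (Set.toFinite _).measurableSet
  rw [← integral_add_compl hm hf, add_comm, Set.insert_eq,
    setIntegral_union (by simpa using hab) (measurableSet_singleton b) hf.integrableOn
      hf.integrableOn]
  simp [measureReal_def]

/-- A finitely supported member of `BMS(c)` with two distinct atoms in `[z,1]`
does not achieve the minimum of `Λ_·(z)` over the family: some other member
has strictly smaller `Λ` value at `z`. Hence any minimizer has at most one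
probability mass on `[z,1]`. -/
theorem two_masses_not_minimal
    (c : ℝ) (hc0 : 0 < c) (hc1 : c < 1) (z : ℝ) (hz : z ∈ Set.Icc (0:ℝ) 1)
    (μ : Measure ℝ) (hprob : IsProbabilityMeasure μ)
    (hsupp : μ (Set.Icc (0:ℝ) 1)ᶜ = 0)
    (hfin : ∃ s : Finset ℝ, μ ((s : Set ℝ))ᶜ = 0)
    (hcap : ∫ x, hD x ∂μ = 1 - c)
    (xm xp : ℝ) (hxm : xm ∈ Set.Icc z 1) (hxp : xp ∈ Set.Icc z 1)
    (hlt : xm < xp) (hμxm : 0 < μ {xm}) (hμxp : 0 < μ {xp}) :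
    ∃ ν : Measure ℝ, IsProbabilityMeasure ν ∧ ν (Set.Icc (0:ℝ) 1)ᶜ = 0 ∧
      (∫ x, hD x ∂ν) = 1 - c ∧ Lam ν z < Lam μ z := by
  obtain ⟨s, hs⟩ := hfin
  have hp : 0 < μ.real {xm} := ENNReal.toReal_pos hμxm.ne' (measure_ne_top _ _)
  have hq : 0 < μ.real {xp} := ENNReal.toReal_pos hμxp.ne' (measure_ne_top _ _)
  have hxm0 : 0 ≤ xm := hz.1.trans hxm.1
  obtain ⟨y, hy, hyent, hybar⟩ := exists_merge_hD hxm0 hlt hxp.2 hp hq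
  set ν : Measure ℝ := μ.restrict ({xm, xp} : Set ℝ)ᶜ +
    (μ {xm} + μ {xp}) • Measure.dirac y with hν
  have hint (f : ℝ → ℝ) : Integrable f μ := integrable_of_compl_finset_null hs f
  have hνint (f : ℝ → ℝ) : ∫ x, f x ∂ν = ∫ x in ({xm, xp} : Set ℝ)ᶜ, f x ∂μ +
      (μ.real {xm} + μ.real {xp}) * f y := by
    rw [hν, integral_add_measure (hint f).integrableOn
      ((integrable_dirac (by simp)).smul_measure (by finiteness)), integral_smul_measure,
      integral_dirac, ENNReal.toReal_add (by finiteness) (by finiteness)]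
    rfl
  have hpair : μ ({xm, xp} : Set ℝ) = μ {xm} + μ {xp} := by
    rw [Set.insert_eq, measure_union (by simpa using hlt.ne) (measurableSet_singleton _)]
  refine ⟨ν, ⟨?_⟩, ?_, ?_, ?_⟩
  · have hm : MeasurableSet ({xm, xp} : Set ℝ) := (Set.toFinite _).measurableSet
    rw [hν, ← hpair]
    simp [add_comm _ (μ {xm, xp}), measure_add_measure_compl hm]
  · have hy01 : y ∈ Icc (0 : ℝ) 1 := ⟨hxm0.trans hy.1, hy.2.trans hxp.2⟩
    have h0 : μ.restrict ({xm, xp} : Set ℝ)ᶜ (Icc (0 : ℝ) 1)ᶜ = 0 :=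
      le_antisymm ((Measure.restrict_apply_le _ _).trans hsupp.le) zero_le
    rw [hν, Measure.add_apply, h0, Measure.smul_apply,
      Measure.dirac_apply' _ measurableSet_Icc.compl, Set.indicator_of_notMem (by simpa using hy01)]
    simp
  · rw [hνint, hyent, ← setIntegral_compl_pair (hint hD) hlt.ne, hcap]
  · rw [Lam, Lam, hνint, setIntegral_compl_pair (hint _) hlt.ne,
      max_eq_right (hxm.1.trans hy.1), max_eq_right hxm.1, max_eq_right hxp.1]
    linarith
end

section
/- Fix c with 0 < c < 1 and z ∈ (0,1). Suppose (γ, x) with γ ∈ (0,1) and x ∈ (0,1) minimizes the objective γ'·(1-z) + (1-γ')·(1-x') over all pairs (γ', x') ∈ [0,1] × [0,1] subject to the constraint γ' + (1-γ')·h(x') = 1 - c. Then γ = (1 - c - h(x))/(1 - h(x)) and x satisfies (1+z)·log₂(1+x) + (1-z)·log₂(1-x) = 0, equivalently the fixed-point equation x = (1-x)^{(z-1)/(z+1)} - 1. -/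
open MeasureTheory Real Set

/-- The entropy deficit `1 - h(y)` in terms of natural logarithms. -/
theorem one_sub_hD_eq {y : ℝ} (hy : -1 < y) (hy' : y < 1) :
    1 - hD y =
      ((1 + y) * Real.log (1 + y) + (1 - y) * Real.log (1 - y)) / (2 * Real.log 2) := by
  have hlog : Real.log 2 ≠ 0 := (Real.log_pos one_lt_two).ne'
  have hcompl : 1 - (1 - y) / 2 = (1 + y) / 2 := by ring
  unfold hD h2
  rw [hcompl, Real.logb, Real.logb, Real.log_div (by linarith) two_ne_zero,
    Real.log_div (by linarith) two_ne_zero]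
  field_simp
  ring

theorem hasDerivAt_one_sub_hD {x : ℝ} (hx : -1 < x) (hx' : x < 1) :
    HasDerivAt (fun y => 1 - hD y)
      ((Real.log (1 + x) - Real.log (1 - x)) / (2 * Real.log 2)) x := by
  have hplus : HasDerivAt (fun y : ℝ => 1 + y) 1 x := (hasDerivAt_id x).const_add 1
  have hminus : HasDerivAt (fun y : ℝ => 1 - y) (-1) x := (hasDerivAt_id x).const_sub 1
  have hp : 1 + x ≠ 0 := by linarith
  have hm : 1 - x ≠ 0 := by linarith
  have hderiv := ((hplus.mul (hplus.log hp)).add (hminus.mul (hminus.log hm))).div_const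
    (2 * Real.log 2)
  refine (hderiv.congr_of_eventuallyEq ?_).congr_deriv ?_
  · filter_upwards [Ioo_mem_nhds hx hx'] with y hy
    exact one_sub_hD_eq hy.1 hy.2
  · congr 1
    field_simp
    ring

/-- First-order conditions for the optimization problem: a minimizer `(γ, x)`
of `γ'·(1-z) + (1-γ')·(1-x')` subject to `γ' + (1-γ')·h(x') = 1 - c`
satisfies `γ = (1-c-h(x))/(1-h(x))` and the fixed-point equation
`x = (1-x)^{(z-1)/(z+1)} - 1`. -/
theorem optimization_first_order_conditions
    (c z : ℝ) (hc0 : 0 < c) (hc1 : c < 1) (hz0 : 0 < z) (hz1 : z < 1)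
    (γ x : ℝ) (hγ0 : 0 < γ) (hγ1 : γ < 1) (hx0 : 0 < x) (hx1 : x < 1)
    (hconstraint : γ + (1 - γ) * hD x = 1 - c)
    (hmin : ∀ γ' x', γ' ∈ Set.Icc (0:ℝ) 1 → x' ∈ Set.Icc (0:ℝ) 1 →
      γ' + (1 - γ') * hD x' = 1 - c →
      γ * (1 - z) + (1 - γ) * (1 - x) ≤ γ' * (1 - z) + (1 - γ') * (1 - x')) :
    γ = (1 - c - hD x) / (1 - hD x) ∧
      (1 + z) * Real.logb 2 (1 + x) + (1 - z) * Real.logb 2 (1 - x) = 0 ∧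
      x = (1 - x) ^ ((z - 1) / (z + 1)) - 1 := by
  have hdef : (1 - γ) * (1 - hD x) = c := by linarith
  have hDpos : 0 < 1 - hD x := by
    by_contra hneg
    nlinarith
  have hlog : 0 < Real.log 2 := Real.log_pos one_lt_two
  have hderiv := hasDerivAt_one_sub_hD (show -1 < x by linarith) hx1
  have hγeq : γ = (1 - c - hD x) / (1 - hD x) := by
    rw [eq_div_iff hDpos.ne']
    linarith
  have hlocal : IsLocalMin (fun y => (z - y) / (1 - hD y)) x := by
    have hlt : c < 1 - hD x := by nlinarith
    filter_upwards [Ioo_mem_nhds hx0 hx1, hderiv.continuousAt.eventually (lt_mem_nhds hlt)]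
      with y hy hcy
    have hypos : 0 < 1 - hD y := hc0.trans hcy
    have hweight : c / (1 - hD y) * (1 - hD y) = c := div_mul_cancel₀ c hypos.ne'
    have hle : c / (1 - hD y) ≤ 1 := (div_le_one hypos).2 hcy.le
    have hnonneg : 0 ≤ c / (1 - hD y) := by positivity
    have hval := hmin (1 - c / (1 - hD y)) y ⟨by linarith, by linarith⟩ ⟨hy.1.le, hy.2.le⟩
      (by linarith)
    have hγ : 1 - γ = c / (1 - hD x) := by
      rw [eq_div_iff hDpos.ne', hdef]
    have hscaled : c * ((z - x) / (1 - hD x)) ≤ c * ((z - y) / (1 - hD y)) := by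
      calc c * ((z - x) / (1 - hD x)) = (1 - γ) * (z - x) := by rw [hγ]; ring
        _ ≤ c / (1 - hD y) * (z - y) := by linarith
        _ = c * ((z - y) / (1 - hD y)) := by ring
    exact le_of_mul_le_mul_left hscaled hc0
  have hcrit : (1 + z) * Real.log (1 + x) + (1 - z) * Real.log (1 - x) = 0 := by
    have hzero := hlocal.hasDerivAt_eq_zero
      (((hasDerivAt_id x).const_sub z).div hderiv hDpos.ne')
    rw [div_eq_zero_iff, or_iff_left (pow_ne_zero 2 hDpos.ne'),
      one_sub_hD_eq (by linarith) hx1] at hzero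
    simp only [id_eq] at hzero
    field_simp at hzero
    linarith
  refine ⟨hγeq, ?_, ?_⟩
  · rw [Real.logb, Real.logb, ← mul_div_assoc, ← mul_div_assoc, ← add_div, hcrit, zero_div]
  · have hexp : Real.log (1 - x) * ((z - 1) / (z + 1)) = Real.log (1 + x) := by
      rw [← mul_div_assoc, div_eq_iff (by linarith)]
      linarith
    rw [Real.rpow_def_of_pos (by linarith), hexp, Real.exp_log (by linarith)]
    ring
end
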